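/- Let G ∈ H^∞_{m×p} with T_G T_G* strictly positive, and assume the associated function Y belongs to H^∞_{p×p}. Then z ↦ Y(z)⁻¹ also belongs to H^∞_{p×p} (Y is invertible outer), and a function X ∈ H^∞_{p×m} satisfies G(z)X(z) = I_m for all z ∈ 𝔻 if and only if X(z) = Y(z)Ξ₀ + Y(z)Θ₀V(z) for some V ∈ H^∞_{(p−m)×m}. -/

import Mathlib

/-!
Setting: `l2 n` models ℓ²₊(ℂⁿ); `lp.single 2 0` is the canonical embedding `E_n`, and
evaluating a sequence at coordinate `k` realizes `E_n* (S_n*)^k`.  Block Toeplitz and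
Hankel operators, as well as the (bounded) inverse of `T_G T_G*`, are specified through
their actions on the standard basis vectors of the coordinate spaces.
-/

noncomputable section
open scoped Matrix

/-- ℂⁿ with the Euclidean norm. -/
abbrev ES (n : ℕ) : Type := EuclideanSpace ℂ (Fin n)

/-- ℓ²₊(ℂⁿ). -/
abbrev l2 (n : ℕ) : Type := lp (fun _ : ℕ => ES n) 2

/-- The `b`-th standard basis vector of ℂⁿ. -/
abbrev eVec (n : ℕ) (b : Fin n) : ES n := EuclideanSpace.single b 1

/-- The matrix function `z ↦ ∑' ν, z ^ ν • F ν` determined by a coefficient sequence. -/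
def seriesM {r s : ℕ} (F : ℕ → Matrix (Fin r) (Fin s) ℂ) (z : ℂ) :
    Matrix (Fin r) (Fin s) ℂ :=
  Matrix.of fun a b => ∑' ν : ℕ, z ^ ν * F ν a b

open MeasureTheory in
/-- Parseval's identity for an absolutely convergent one-sided Fourier series. -/
theorem hasSum_norm_sq_integral_fourier (a : ℕ → ℂ) (ha : Summable fun n => ‖a n‖) :
    Integrable (fun t : AddCircle (1 : ℝ) => ‖∑' n, a n * fourier (n : ℤ) t‖ ^ 2)
      AddCircle.haarAddCircle ∧
    HasSum (fun n => ‖a n‖ ^ 2)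
      (∫ t : AddCircle (1 : ℝ), ‖∑' n, a n * fourier (n : ℤ) t‖ ^ 2
        ∂AddCircle.haarAddCircle) := by
  have hs : Summable fun n : ℕ => a n • (fourier (n : ℤ) : C(AddCircle (1 : ℝ), ℂ)) := by
    refine Summable.of_norm ?_
    have h1 : Fact ((0 : ℝ) < 1) := ⟨one_pos⟩
    simpa only [norm_smul, fourier_norm, mul_one] using ha
  set F : C(AddCircle (1 : ℝ), ℂ) := ∑' n : ℕ, a n • fourier (n : ℤ) with hF
  have hFt : ∀ t, F t = ∑' n, a n * fourier (n : ℤ) t := fun t => by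
    have := (hs.hasSum.mapL (ContinuousMap.evalCLM ℂ t)).tsum_eq
    simpa using this.symm
  set L := ContinuousMap.toLp (E := ℂ) 2 (AddCircle.haarAddCircle (T := (1 : ℝ))) ℂ with hL
  have h1 : HasSum (fun n : ℕ => a n • fourierLp (T := (1 : ℝ)) 2 (n : ℤ)) (L F) := by
    simpa [hL, fourierLp] using hs.hasSum.mapL L
  have h2 : ∀ n : ℕ, inner ℂ (fourierLp (T := (1 : ℝ)) 2 (n : ℤ)) (L F) = a n := fun n => by
    have h := h1.mapL (innerSL ℂ (fourierLp (T := (1 : ℝ)) 2 (n : ℤ)))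
    have h' : ∀ k : ℕ, innerSL ℂ (fourierLp (T := (1 : ℝ)) 2 (n : ℤ))
        (a k • fourierLp (T := (1 : ℝ)) 2 (k : ℤ)) = if k = n then a n else 0 := fun k => by
      rw [innerSL_apply_apply, inner_smul_right,
        orthonormal_iff_ite.mp (orthonormal_fourier (T := (1 : ℝ)))]
      by_cases hk : k = n
      · simp [hk]
      · simp [hk, Ne.symm hk]
    simp only [h'] at h
    exact h.unique (hasSum_ite_eq n (a n))
  have h3 : HasSum (fun n => ((‖a n‖ ^ 2 : ℝ) : ℂ)) (inner ℂ (L F) (L F)) := by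
    have h := h1.mapL (innerSL ℂ (L F))
    simp only [innerSL_apply_apply, inner_smul_right] at h
    refine h.congr_fun fun n => ?_
    rw [← inner_conj_symm, h2, Complex.mul_conj, Complex.normSq_eq_norm_sq]
  have h4 : inner ℂ (L F) (L F) = ((∫ t : AddCircle (1 : ℝ), ‖F t‖ ^ 2
      ∂AddCircle.haarAddCircle : ℝ) : ℂ) := by
    rw [hL, ContinuousMap.inner_toLp, ← integral_complex_ofReal]
    refine integral_congr_ae (Filter.Eventually.of_forall fun t => ?_)
    simp only
    rw [← Complex.normSq_eq_norm_sq, ← Complex.mul_conj, starRingEnd_apply]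
  simp only [← hFt]
  rw [h4] at h3
  refine ⟨?_, by exact_mod_cast h3⟩
  exact ((F.continuous.norm.pow 2).integrable_of_hasCompactSupport
    (HasCompactSupport.of_compactSpace _))

/-- Evaluation of the analytic function with coefficients `f`. -/
def diskEval {n : ℕ} (z : ℂ) (hz : ‖z‖ < 1) : l2 n →L[ℂ] ES n :=
  LinearMap.mkContinuous
    { toFun := fun f => ∑' i : ℕ, z ^ i • f i
      map_add' := fun f g => by
        have hs : ∀ f : l2 n, Summable fun i : ℕ => z ^ i • f i := fun f => by
          refine Summable.of_norm_bounded
            ((summable_geometric_of_lt_one (norm_nonneg z) hz).mul_right ‖f‖) fun i => ?_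
          rw [norm_smul, norm_pow]
          gcongr
          exact lp.norm_apply_le_norm two_ne_zero f i
        rw [← (hs f).tsum_add (hs g)]
        simp
      map_smul' := fun c f => by
        simp only [RingHom.id_apply]
        rw [← tsum_const_smul'']
        simp [smul_comm c] }
    (1 - ‖z‖)⁻¹ (fun f => by
      refine tsum_of_norm_bounded
        ((hasSum_geometric_of_lt_one (norm_nonneg z) hz).mul_right ‖f‖) fun i => ?_
      rw [norm_smul, norm_pow]
      gcongr
      exact lp.norm_apply_le_norm two_ne_zero f i)

theorem summable_pow_smul {n : ℕ} {z : ℂ} (hz : ‖z‖ < 1) (f : l2 n) :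
    Summable fun i : ℕ => ‖z ^ i • f i‖ := by
  refine Summable.of_nonneg_of_le (fun _ => norm_nonneg _) (fun i => ?_)
    ((summable_geometric_of_lt_one (norm_nonneg z) hz).mul_right ‖f‖)
  rw [norm_smul, norm_pow]
  gcongr
  exact lp.norm_apply_le_norm two_ne_zero f i

theorem diskEval_hasSum {n : ℕ} {z : ℂ} (hz : ‖z‖ < 1) (f : l2 n) :
    HasSum (fun i : ℕ => z ^ i • f i) (diskEval z hz f) :=
  (summable_pow_smul hz f).of_norm.hasSum

theorem diskEval_apply_hasSum {n : ℕ} {z : ℂ} (hz : ‖z‖ < 1) (f : l2 n) (a : Fin n) :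
    HasSum (fun i : ℕ => z ^ i * f i a) (diskEval z hz f a) := by
  simpa using (diskEval_hasSum hz f).mapL (EuclideanSpace.proj a)

theorem diskEval_zero {n : ℕ} (f : l2 n) : diskEval 0 (by simp) f = f 0 := by
  refine (diskEval_hasSum _ f).unique ?_
  convert hasSum_single 0 _ using 1
  · simp
  · intro i hi
    simp [hi]

theorem diskEval_single {n : ℕ} {z : ℂ} (hz : ‖z‖ < 1) (j : ℕ) (c : ES n) :
    diskEval z hz (lp.single 2 j c) = z ^ j • c := by
  refine (diskEval_hasSum hz _).unique ?_
  convert hasSum_single j _ using 1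
  · simp
  · intro i hi
    simp [hi]

/-- A sequence is determined by the values of its generating function on the disc. -/
theorem eq_of_diskEval_eq {n : ℕ} {f g : l2 n}
    (h : ∀ (z : ℂ) (hz : ‖z‖ < 1), diskEval z hz f = diskEval z hz g) : f = g := by
  have key : ∀ f : l2 n, (∀ (z : ℂ) (hz : ‖z‖ < 1), diskEval z hz f = 0) → f = 0 := by
    intro f hf
    let P : FormalMultilinearSeries ℂ ℂ (ES n) := fun k =>
      ContinuousMultilinearMap.mkPiRing ℂ (Fin k) (f k)
    have hP : HasFPowerSeriesAt (fun _ : ℂ => (0 : ES n)) P 0 := by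
      rw [hasFPowerSeriesAt_iff]
      filter_upwards [Metric.ball_mem_nhds (0 : ℂ) one_pos] with z hz
      have hz' : ‖z‖ < 1 := by simpa using hz
      have := diskEval_hasSum hz' f
      rw [hf] at this
      simpa [P, FormalMultilinearSeries.coeff] using this
    have h0 := hP.eq_zero
    ext1
    funext k
    have := congrArg (fun Q => Q.coeff k) h0
    simpa [P, FormalMultilinearSeries.coeff] using this
  rw [← sub_eq_zero]
  exact key _ fun z hz => by rw [map_sub, h, sub_self]

/-- The Szegő kernel vector `∑ conj(z)^i S^i E v`. -/
def szego {n : ℕ} (z : ℂ) (hz : ‖z‖ < 1) (v : ES n) : l2 n :=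
  (diskEval z hz).adjoint v

theorem inner_szego {n : ℕ} {z : ℂ} (hz : ‖z‖ < 1) (v : ES n) (f : l2 n) :
    inner ℂ (szego z hz v) f = inner ℂ v (diskEval z hz f) :=
  ContinuousLinearMap.adjoint_inner_left _ _ _

theorem szego_apply {n : ℕ} {z : ℂ} (hz : ‖z‖ < 1) (v : ES n) (i : ℕ) :
    (szego z hz v) i = (starRingEnd ℂ z) ^ i • v := by
  refine ext_inner_right ℂ fun w => ?_
  rw [← lp.inner_single_right, inner_szego, diskEval_single, inner_smul_right, inner_smul_left]
  simp

theorem norm_sq_szego {n : ℕ} {z : ℂ} (hz : ‖z‖ < 1) (v : ES n) :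
    (1 - ‖z‖ ^ 2) * ‖szego z hz v‖ ^ 2 = ‖v‖ ^ 2 := by
  have h1 : ‖z‖ ^ 2 < 1 := by nlinarith [norm_nonneg z]
  have h := lp.norm_rpow_eq_tsum (p := 2) (by simp) (szego z hz v)
  simp only [ENNReal.toReal_ofNat, Real.rpow_two, szego_apply, norm_smul, norm_pow,
    RCLike.norm_conj, mul_pow] at h
  simp only [← pow_mul, mul_comm _ 2] at h
  simp only [pow_mul] at h
  rw [h, tsum_mul_right, tsum_geometric_of_lt_one (by positivity) h1, ← mul_assoc,
    mul_inv_cancel₀ (by linarith), one_mul]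

theorem hasSum_norm_sq_l2 {n : ℕ} (f : l2 n) : HasSum (fun i => ‖f i‖ ^ 2) (‖f‖ ^ 2) := by
  have h := lp.hasSum_norm (p := 2) (by simp) f
  simpa only [ENNReal.toReal_ofNat, Real.rpow_two] using h

open MeasureTheory in
/-- If `|ψ|² ≤ c ‖u‖²` pointwise on the disc for `u` in the vector-valued Hardy space, then the
Taylor coefficients of `ψ` are square summable, with sum at most `c ‖u‖²`. -/
theorem exists_taylor_sq_sum_le {p : ℕ} (ψ : ℂ → ℂ)
    (hψ : DifferentiableOn ℂ ψ (Metric.ball 0 1)) (u : l2 p) (c : ℝ) (hc : 0 ≤ c)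
    (hle : ∀ (z : ℂ) (hz : ‖z‖ < 1), ‖ψ z‖ ^ 2 ≤ c * ‖diskEval z hz u‖ ^ 2) :
    ∃ d : ℕ → ℂ, (∀ z : ℂ, ‖z‖ < 1 → HasSum (fun n => z ^ n * d n) (ψ z)) ∧
      ∀ s : Finset ℕ, ∑ n ∈ s, ‖d n‖ ^ 2 ≤ c * ‖u‖ ^ 2 := by
  have hd : ∀ z : ℂ, ‖z‖ < 1 →
      HasSum (fun n : ℕ => z ^ n * ((n.factorial : ℂ)⁻¹ * iteratedDeriv n ψ 0)) (ψ z) := by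
    intro z hz
    have h := Complex.hasSum_taylorSeries_on_ball hψ (z := z) (by simpa using hz)
    refine h.congr_fun fun n => ?_
    simp only [sub_zero, smul_eq_mul]
    ring
  obtain ⟨d, hd⟩ : ∃ d : ℕ → ℂ, ∀ z : ℂ, ‖z‖ < 1 → HasSum (fun n => z ^ n * d n) (ψ z) := ⟨_, hd⟩
  refine ⟨d, hd, fun s => ?_⟩
  have hr : ∀ r : ℝ, r ∈ Set.Ioo (0 : ℝ) 1 → ∑ n ∈ s, ‖(r : ℂ) ^ n * d n‖ ^ 2 ≤ c * ‖u‖ ^ 2 := by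
    intro r ⟨hr0, hr1⟩
    have hrn : ‖(r : ℂ)‖ < 1 := by simpa [abs_of_pos hr0] using hr1
    have hz : ∀ t : AddCircle (1 : ℝ), ‖(r : ℂ) * fourier 1 t‖ < 1 := fun t => by
      rw [norm_mul, fourier_one, Circle.norm_coe, mul_one]
      exact hrn
    have hpow : ∀ (t : AddCircle (1 : ℝ)) (n : ℕ) (x : ℂ), (r : ℂ) ^ n * x * fourier (n : ℤ) t =
        ((r : ℂ) * fourier 1 t) ^ n * x := fun t n x => by
      rw [mul_pow, fourier_one, fourier_apply, AddCircle.toCircle_zsmul]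
      push_cast
      rw [zpow_natCast]
      ring
    obtain ⟨-, hψ2⟩ := hasSum_norm_sq_integral_fourier _ (hd r hrn).summable.norm
    have hψt : ∀ t : AddCircle (1 : ℝ), ∑' n : ℕ, (r : ℂ) ^ n * d n * fourier (n : ℤ) t =
        ψ ((r : ℂ) * fourier 1 t) := fun t => by
      simp only [hpow]
      exact (hd _ (hz t)).tsum_eq
    have hu := fun b : Fin p => hasSum_norm_sq_integral_fourier _
      (diskEval_apply_hasSum hrn u b).summable.norm
    have hut : ∀ (b : Fin p) (t : AddCircle (1 : ℝ)),
        ∑' n : ℕ, (r : ℂ) ^ n * u n b * fourier (n : ℤ) t =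
        diskEval ((r : ℂ) * fourier 1 t) (hz t) u b := fun b t => by
      simp only [hpow]
      exact (diskEval_apply_hasSum (hz t) u b).tsum_eq
    simp only [hψt] at hψ2
    simp only [hut] at hu
    calc ∑ n ∈ s, ‖(r : ℂ) ^ n * d n‖ ^ 2
        ≤ ∫ t : AddCircle (1 : ℝ), ‖ψ ((r : ℂ) * fourier 1 t)‖ ^ 2 ∂AddCircle.haarAddCircle :=
          sum_le_hasSum s (fun _ _ => by positivity) hψ2
      _ ≤ ∫ t : AddCircle (1 : ℝ), c * ∑ b, ‖diskEval ((r : ℂ) * fourier 1 t) (hz t) u b‖ ^ 2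
            ∂AddCircle.haarAddCircle := by
          refine integral_mono_of_nonneg (Filter.Eventually.of_forall fun t => by positivity)
            ((integrable_finsetSum _ fun b _ => (hu b).1).const_mul c)
            (Filter.Eventually.of_forall fun t => ?_)
          have := hle _ (hz t)
          rwa [EuclideanSpace.norm_sq_eq] at this
      _ = c * ∑ b, ∫ t : AddCircle (1 : ℝ), ‖diskEval ((r : ℂ) * fourier 1 t) (hz t) u b‖ ^ 2
            ∂AddCircle.haarAddCircle := by
          rw [integral_const_mul, integral_finsetSum _ fun b _ => (hu b).1]
      _ ≤ c * ‖u‖ ^ 2 := by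
          gcongr
          refine hasSum_le (fun n => ?_) (hasSum_sum fun b _ => (hu b).2) (hasSum_norm_sq_l2 u)
          rw [EuclideanSpace.norm_sq_eq]
          gcongr with b
          rw [norm_mul, norm_pow]
          exact mul_le_of_le_one_left (norm_nonneg _) (pow_le_one₀ (norm_nonneg _) hrn.le)
  have hcont : Filter.Tendsto (fun r : ℝ => ∑ n ∈ s, ‖(r : ℂ) ^ n * d n‖ ^ 2)
      (nhdsWithin 1 (Set.Iio 1)) (nhds (∑ n ∈ s, ‖((1 : ℝ) : ℂ) ^ n * d n‖ ^ 2)) := by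
    refine Filter.Tendsto.mono_left (Continuous.tendsto ?_ 1) nhdsWithin_le_nhds
    fun_prop
  simp only [Complex.ofReal_one, one_pow, one_mul] at hcont
  refine le_of_tendsto hcont ?_
  filter_upwards [Ioo_mem_nhdsLT (zero_lt_one (α := ℝ))] with r h using hr r h

theorem differentiableOn_tsum_l2 {n : ℕ} (u : l2 n) (b : Fin n) :
    DifferentiableOn ℂ (fun z : ℂ => ∑' i : ℕ, z ^ i * u i b) (Metric.ball 0 1) := by
  intro z hz
  have hz' : ‖z‖ < 1 := by simpa using hz
  obtain ⟨r, hzr, hr1⟩ := exists_between hz'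
  have hr0 : 0 ≤ r := (norm_nonneg z).trans hzr.le
  have hd : DifferentiableOn ℂ (fun z => ∑' i : ℕ, z ^ i * u i b) (Metric.ball 0 r) := by
    refine Complex.differentiableOn_tsum_of_summable_norm (u := fun i => r ^ i * ‖u‖)
      ((summable_geometric_of_lt_one hr0 hr1).mul_right _) (fun i => by fun_prop)
      Metric.isOpen_ball fun i w hw => ?_
    have hw' : ‖w‖ < r := by simpa using hw
    rw [norm_mul, norm_pow]
    gcongr
    exact (PiLp.norm_apply_le _ _).trans (lp.norm_apply_le_norm two_ne_zero u i)
  exact (hd.differentiableAt (Metric.isOpen_ball.mem_nhds (by simpa using hzr)))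
    |>.differentiableWithinAt

/-- Multiplication by a bounded analytic matrix function is bounded on `ℓ²₊`. -/
theorem exists_bounded_mul_l2 {p q : ℕ} (Y : ℂ → Matrix (Fin q) (Fin p) ℂ)
    (hY : ∀ a b, DifferentiableOn ℂ (fun z => Y z a b) (Metric.ball 0 1))
    (hbdd : ∃ C : ℝ, ∀ z ∈ Metric.ball (0 : ℂ) 1, ∀ a b, ‖Y z a b‖ ≤ C) :
    ∃ K : ℝ, 0 ≤ K ∧ ∀ u : l2 p, ∃ g : l2 q, ‖g‖ ≤ K * ‖u‖ ∧ ∀ (z : ℂ) (hz : ‖z‖ < 1),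
      diskEval z hz g = WithLp.toLp 2 (Y z *ᵥ (diskEval z hz u).ofLp) := by
  obtain ⟨C, hC⟩ := hbdd
  refine ⟨√(q * (C ^ 2 * p)), by positivity, fun u => ?_⟩
  let φ : Fin p → ℂ → ℂ := fun b z => ∑' i : ℕ, z ^ i * u i b
  have hφ : ∀ b, DifferentiableOn ℂ (φ b) (Metric.ball 0 1) := differentiableOn_tsum_l2 u
  have hφu : ∀ b z (hz : ‖z‖ < 1), φ b z = diskEval z hz u b :=
    fun b z hz => (diskEval_apply_hasSum hz u b).tsum_eq
  have hψ : ∀ a : Fin q, DifferentiableOn ℂ (fun z => ∑ b, Y z a b * φ b z) (Metric.ball 0 1) :=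
    fun a => DifferentiableOn.fun_sum fun b _ => (hY a b).mul (hφ b)
  have hle : ∀ (a : Fin q) (z : ℂ) (hz : ‖z‖ < 1),
      ‖∑ b, Y z a b * φ b z‖ ^ 2 ≤ C ^ 2 * p * ‖diskEval z hz u‖ ^ 2 := by
    intro a z hz
    calc ‖∑ b, Y z a b * φ b z‖ ^ 2 ≤ (∑ b, ‖Y z a b‖ * ‖φ b z‖) ^ 2 := by
          gcongr
          exact norm_sum_le_of_le _ fun b _ => norm_mul_le _ _
      _ ≤ (∑ b, ‖Y z a b‖ ^ 2) * ∑ b, ‖φ b z‖ ^ 2 := Finset.sum_mul_sq_le_sq_mul_sq _ _ _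
      _ ≤ C ^ 2 * p * ‖diskEval z hz u‖ ^ 2 := by
          rw [EuclideanSpace.norm_sq_eq]
          simp only [hφu _ z hz]
          gcongr
          refine (Finset.sum_le_card_nsmul _ _ (C ^ 2) fun b _ => ?_).trans_eq ?_
          · gcongr
            exact hC z (by simpa using hz) a b
          · simp [mul_comm]
  choose d hd hdle using fun a => exists_taylor_sq_sum_le _ (hψ a) u _ (by positivity) (hle a)
  have hsum : ∀ s : Finset ℕ, ∑ n ∈ s, ‖(WithLp.toLp 2 fun a => d a n : ES q)‖ ^ 2 ≤
      q * (C ^ 2 * p) * ‖u‖ ^ 2 := by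
    intro s
    simp only [EuclideanSpace.norm_sq_eq]
    rw [Finset.sum_comm]
    refine (Finset.sum_le_card_nsmul _ _ _ fun a _ => hdle a s).trans_eq ?_
    simp [mul_assoc]
  let g : l2 q := ⟨fun n => WithLp.toLp 2 fun a => d a n, memℓp_gen' (C := q * (C ^ 2 * p) * ‖u‖ ^ 2)
    (by simpa only [ENNReal.toReal_ofNat, Real.rpow_two] using hsum)⟩
  refine ⟨g, ?_, fun z hz => ?_⟩
  · rw [← Real.sqrt_sq (norm_nonneg u), ← Real.sqrt_mul (by positivity)]
    exact Real.le_sqrt_of_sq_le ((hasSum_norm_sq_l2 g).summable.tsum_le_of_sum_le hsum |>.trans'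
      (hasSum_norm_sq_l2 g).tsum_eq.ge)
  · ext a
    refine (diskEval_apply_hasSum hz g a).unique ?_
    convert hd a z hz using 1
    simp [Matrix.mulVec, dotProduct, hφu _ z hz]

/-- The forward shift. -/
def shiftUp {n : ℕ} (f : l2 n) : l2 n :=
  ⟨fun i => Nat.casesOn i 0 fun k => f k, memℓp_gen (by
    rw [← summable_nat_add_iff 1]
    simpa using (hasSum_norm_sq_l2 f).summable)⟩

/-- The backward shift. -/
def shiftDown {n : ℕ} (f : l2 n) : l2 n :=
  ⟨fun i => f (i + 1), memℓp_gen (by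
    simpa using (summable_nat_add_iff 1).mpr (hasSum_norm_sq_l2 f).summable)⟩

@[simp]
theorem shiftUp_zero {n : ℕ} (f : l2 n) : (shiftUp f) 0 = 0 := rfl

@[simp]
theorem shiftUp_succ {n : ℕ} (f : l2 n) (i : ℕ) : (shiftUp f) (i + 1) = f i := rfl

@[simp]
theorem shiftDown_apply {n : ℕ} (f : l2 n) (i : ℕ) : (shiftDown f) i = f (i + 1) := rfl

theorem shiftDown_shiftUp {n : ℕ} (f : l2 n) : shiftDown (shiftUp f) = f := rfl

theorem shiftUp_shiftDown {n : ℕ} {f : l2 n} (hf : f 0 = 0) : shiftUp (shiftDown f) = f := by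
  ext1
  funext i
  cases i with
  | zero => simp [hf]
  | succ k => simp

theorem inner_shiftUp_left {n : ℕ} (g f : l2 n) :
    inner ℂ (shiftUp g) f = inner ℂ g (shiftDown f) := by
  rw [lp.inner_eq_tsum, lp.inner_eq_tsum, (lp.summable_inner (𝕜 := ℂ) (shiftUp g) f).tsum_eq_zero_add]
  simp

theorem diskEval_shiftUp {n : ℕ} {z : ℂ} (hz : ‖z‖ < 1) (f : l2 n) :
    diskEval z hz (shiftUp f) = z • diskEval z hz f := by
  refine (diskEval_hasSum hz _).unique ?_
  rw [← hasSum_nat_add_iff' 1]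
  simpa [pow_succ', mul_smul] using (diskEval_hasSum hz f).const_smul z

/-- Two continuous linear maps on `ℓ²₊` agreeing on the standard basis coincide. -/
theorem l2_ext_basis {n : ℕ} {F : Type*} [NormedAddCommGroup F] [NormedSpace ℂ F]
    {A B : l2 n →L[ℂ] F} (h : ∀ j b, A (lp.single 2 j (eVec n b)) = B (lp.single 2 j (eVec n b))) :
    A = B := by
  refine lp.ext_continuousLinearMap (by simp) fun j => ?_
  apply ContinuousLinearMap.coe_injective
  refine (EuclideanSpace.basisFun (Fin n) ℂ).toBasis.ext fun b => ?_
  simpa using h j b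

section Toeplitz

variable {m p : ℕ} {T : l2 p →L[ℂ] l2 m} {Gc : ℂ → ES p →L[ℂ] ES m}

/-- Operators acting as multiplication by a function intertwine the shifts. -/
theorem map_shiftUp (hT : ∀ z (hz : ‖z‖ < 1) g, diskEval z hz (T g) = Gc z (diskEval z hz g))
    (f : l2 p) : T (shiftUp f) = shiftUp (T f) :=
  eq_of_diskEval_eq fun z hz => by
    rw [hT, diskEval_shiftUp, diskEval_shiftUp, hT, map_smul]

/-- An element of the wandering subspace of `ker T` is determined by its zeroth coordinate. -/
theorem wandering_unique (hT : ∀ f, T (shiftUp f) = shiftUp (T f)) {d y : l2 p} (h0 : y 0 = d 0)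
    (hTd : T d = 0) (hTy : T y = 0) (hd : ∀ g, T g = 0 → inner ℂ (shiftUp g) d = 0)
    (hy : ∀ g, T g = 0 → inner ℂ (shiftUp g) y = 0) : y = d := by
  have he : (y - d) 0 = 0 := by simp [h0]
  have hTe : T (shiftDown (y - d)) = 0 := by
    rw [← shiftDown_shiftUp (T _), ← hT, shiftUp_shiftDown he, map_sub, hTd, hTy, sub_zero]
    rfl
  rw [← sub_eq_zero, ← inner_self_eq_zero (𝕜 := ℂ)]
  nth_rw 1 [← shiftUp_shiftDown he]
  rw [inner_sub_right, hd _ hTe, hy _ hTe, sub_zero]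

variable {Tinv : l2 m →L[ℂ] l2 m} {Yc : ℂ → ES p →L[ℂ] ES p} {y : ES p → l2 p}

/-- If `q` is the projection of a kernel vector at `z` onto `ker T`, then
`(1 - |z|²) ‖q‖² ≤ ‖Y(z)* v‖²`. -/
theorem norm_sq_proj_szego_le (hT2 : ∀ x, T (T.adjoint (Tinv x)) = x)
    (hT : ∀ z (hz : ‖z‖ < 1) g, diskEval z hz (T g) = Gc z (diskEval z hz g))
    (hy : ∀ z (hz : ‖z‖ < 1) c, diskEval z hz (y c) = Yc z c) (hy0 : ∀ c, (y c) 0 = c)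
    (hyd : ∀ c, ∃ w, shiftDown (y c) = T.adjoint w)
    (hGY : ∀ z, ‖z‖ < 1 → ∀ c, Gc z (Yc z c) = Gc 0 c)
    {z : ℂ} (hz : ‖z‖ < 1) (v : ES p) :
    (1 - ‖z‖ ^ 2) * ‖szego z hz v - T.adjoint (Tinv (T (szego z hz v)))‖ ^ 2 ≤
      ‖(Yc z).adjoint v‖ ^ 2 := by
  set Q : l2 p → l2 p := fun x => x - T.adjoint (Tinv (T x)) with hQ
  have hTQ : ∀ x, T (Q x) = 0 := fun x => by simp [hQ, hT2]
  have hQr : ∀ g x, T g = 0 → inner ℂ g (Q x) = inner ℂ g x := fun g x hg => by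
    simp [hQ, ContinuousLinearMap.adjoint_inner_right, hg]
  have hQl : ∀ g x, T g = 0 → inner ℂ (Q x) g = inner ℂ x g := fun g x hg => by
    simp [hQ, ContinuousLinearMap.adjoint_inner_left, hg]
  have hup := map_shiftUp hT
  have hTup : ∀ g, T g = 0 → T (shiftUp g) = 0 := fun g hg =>
    eq_of_diskEval_eq fun z hz => by rw [hup, hg, diskEval_shiftUp]; simp
  have hwand : ∀ d, T d = 0 → (∀ g, T g = 0 → inner ℂ (shiftUp g) d = 0) →
      ∀ w (hw : ‖w‖ < 1), diskEval w hw d = Yc w (d 0) := by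
    intro d hTd hd w hw
    have hG0 : Gc 0 (d 0) = 0 := by
      have h := (hT 0 (by simp) d).symm
      rwa [hTd, map_zero, diskEval_zero] at h
    rw [← hy w hw, wandering_unique hup (hy0 (d 0)) hTd ?_ hd ?_]
    · refine eq_of_diskEval_eq fun w hw => ?_
      rw [hT, hy, hGY w hw, hG0, map_zero]
    · intro g hg
      obtain ⟨u, hu⟩ := hyd (d 0)
      rw [inner_shiftUp_left, hu, ContinuousLinearMap.adjoint_inner_right, hg, inner_zero_left]
  have hQnorm : ∀ x, ‖Q x‖ ≤ ‖x‖ := by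
    intro x
    have h : ‖Q x‖ ^ 2 ≤ ‖x‖ * ‖Q x‖ := by
      rw [← inner_self_eq_norm_sq (𝕜 := ℂ) (Q x), hQl _ _ (hTQ x)]
      exact re_inner_le_norm _ _
    by_contra! hlt
    nlinarith [norm_nonneg x]
  set q := Q (szego z hz v) with hq
  have hq0 : ‖q 0‖ ≤ ‖(Yc z).adjoint v‖ := by
    have h1 : ∀ u : ES p, inner ℂ u (q 0) =
        inner ℂ ((Q (lp.single 2 0 u)) 0) ((Yc z).adjoint v) := by
      intro u
      have hw := hwand (Q (lp.single 2 0 u)) (hTQ _) (fun g hg => by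
        rw [hQr _ _ (hTup g hg), lp.inner_single_right]; simp) z hz
      have hu : inner ℂ u (q 0) = inner ℂ (lp.single 2 0 u) q := (lp.inner_single_left 0 u q).symm
      rw [hu, ← hQl _ _ (hTQ _), hQr _ _ (hTQ _), ← inner_conj_symm,
        inner_szego, inner_conj_symm, hw, ContinuousLinearMap.adjoint_inner_right]
    have h2 : ‖q 0‖ ^ 2 ≤ ‖q 0‖ * ‖(Yc z).adjoint v‖ := by
      rw [← inner_self_eq_norm_sq (𝕜 := ℂ) (q 0), h1]
      refine (re_inner_le_norm _ _).trans ?_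
      gcongr
      refine (lp.norm_apply_le_norm two_ne_zero _ 0).trans ((hQnorm _).trans ?_)
      rw [lp.norm_single (by simp)]
    by_contra! hlt
    nlinarith [norm_nonneg ((Yc z).adjoint v)]
  have hd := hwand (q - (starRingEnd ℂ z) • shiftUp q)
    (by rw [map_sub, map_smul, hTQ, hTup _ (hTQ _)]; simp)
    (fun g hg => by
      rw [inner_sub_right, inner_smul_right, hq, hQr _ _ (hTup g hg), inner_shiftUp_left,
        inner_shiftUp_left, shiftDown_shiftUp, hQr _ _ hg]
      have : shiftDown (szego z hz v) = (starRingEnd ℂ z) • szego z hz v := by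
        ext1
        funext i
        simp [szego_apply, pow_succ', mul_smul]
      rw [this, inner_smul_right, sub_self]) z hz
  have hd0 : (q - (starRingEnd ℂ z) • shiftUp q) 0 = q 0 := by
    change q 0 - (starRingEnd ℂ z) • (shiftUp q) 0 = q 0
    rw [shiftUp_zero, smul_zero, sub_zero]
  rw [hd0, map_sub, map_smul, diskEval_shiftUp, smul_smul] at hd
  have hval : (((1 - ‖z‖ ^ 2) * ‖q‖ ^ 2 : ℝ) : ℂ) = inner ℂ ((Yc z).adjoint v) (q 0) := by
    have h3 : ((‖q‖ ^ 2 : ℝ) : ℂ) = inner ℂ v (diskEval z hz q) := by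
      rw [← inner_szego, ← hQl _ _ (hTQ _), inner_self_eq_norm_sq_to_K]
      simp [hq]
    rw [ContinuousLinearMap.adjoint_inner_left, ← hd, inner_sub_right, inner_smul_right, ← h3,
      ← Complex.normSq_eq_conj_mul_self, Complex.normSq_eq_norm_sq]
    push_cast
    ring
  calc (1 - ‖z‖ ^ 2) * ‖q‖ ^ 2 = ((((1 - ‖z‖ ^ 2) * ‖q‖ ^ 2 : ℝ) : ℂ)).re :=
        (Complex.ofReal_re _).symm
    _ ≤ ‖(Yc z).adjoint v‖ * ‖q 0‖ := by
        rw [hval]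
        exact re_inner_le_norm (𝕜 := ℂ) _ _
    _ ≤ ‖(Yc z).adjoint v‖ ^ 2 := by
        rw [sq]
        gcongr

/-- Lower bound for `Y(z)*`, uniform in `z`. -/
theorem exists_norm_le_adjoint (hT2 : ∀ x, T (T.adjoint (Tinv x)) = x)
    (hT : ∀ z (hz : ‖z‖ < 1) g, diskEval z hz (T g) = Gc z (diskEval z hz g))
    (hy : ∀ z (hz : ‖z‖ < 1) c, diskEval z hz (y c) = Yc z c) (hy0 : ∀ c, (y c) 0 = c)
    (hyd : ∀ c, ∃ w, shiftDown (y c) = T.adjoint w)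
    (hGY : ∀ z, ‖z‖ < 1 → ∀ c, Gc z (Yc z c) = Gc 0 c)
    (Ξ : ES m →L[ℂ] ES p) (hGΞ : ∀ c, Gc 0 (Ξ c) = c)
    {K : ℝ} (hK : 0 ≤ K) (hmul : ∀ u : l2 m, ∃ g : l2 p, ‖g‖ ≤ K * ‖u‖ ∧
      ∀ z (hz : ‖z‖ < 1), diskEval z hz g = Yc z (Ξ (diskEval z hz u))) :
    ∃ C : ℝ, 0 ≤ C ∧ ∀ z : ℂ, ‖z‖ < 1 → ∀ v, ‖v‖ ≤ C * ‖(Yc z).adjoint v‖ := by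
  refine ⟨(1 + K * ‖T‖) + ‖T.adjoint‖ * ‖Ξ.adjoint‖, by positivity, fun z hz v => ?_⟩
  have hq := norm_sq_proj_szego_le hT2 hT hy hy0 hyd hGY hz v
  set x := szego z hz v with hx
  set q := x - T.adjoint (Tinv (T x)) with hqdef
  set w := Ξ.adjoint ((Yc z).adjoint v) with hw
  set e := x - T.adjoint (szego z hz w) with he
  clear_value e w q x
  obtain ⟨g, hg, hgz⟩ := hmul (T e)
  have hTh : T (e - g) = 0 := eq_of_diskEval_eq fun ζ hζ => by
    rw [map_sub, map_sub, hT _ _ g, hgz, hGY ζ hζ, hGΞ, sub_self, map_zero]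
  have hee : inner ℂ e e = inner ℂ q (e - g) := by
    have h1 : inner ℂ q (e - g) = inner ℂ x (e - g) := by
      rw [hqdef, inner_sub_left, ContinuousLinearMap.adjoint_inner_left, hTh, inner_zero_right,
        sub_zero]
    have h2 : inner ℂ (T.adjoint (szego z hz w)) e = inner ℂ x g := by
      rw [ContinuousLinearMap.adjoint_inner_left, inner_szego, hw,
        ContinuousLinearMap.adjoint_inner_left, ContinuousLinearMap.adjoint_inner_left, ← hgz,
        hx, inner_szego]
    rw [h1, inner_sub_right, ← h2, ← inner_sub_left, ← he]
  have hen : ‖e‖ ≤ (1 + K * ‖T‖) * ‖q‖ := by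
    have h : ‖e‖ ^ 2 ≤ ‖q‖ * ((1 + K * ‖T‖) * ‖e‖) := by
      rw [← inner_self_eq_norm_sq (𝕜 := ℂ) e, hee]
      refine (re_inner_le_norm _ _).trans ?_
      gcongr
      refine (norm_sub_le _ _).trans ?_
      have := hg.trans (mul_le_mul_of_nonneg_left (T.le_opNorm e) hK)
      linarith
    by_contra! hlt
    have : 0 ≤ (1 + K * ‖T‖) * ‖q‖ := by positivity
    nlinarith
  have hz1 : 0 ≤ 1 - ‖z‖ ^ 2 := by nlinarith [norm_nonneg z]
  set s := √(1 - ‖z‖ ^ 2) with hs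
  have hs2 : s ^ 2 = 1 - ‖z‖ ^ 2 := Real.sq_sqrt hz1
  have hsz : ∀ {n : ℕ} (c : ES n), s * ‖szego z hz c‖ = ‖c‖ := fun c => by
    rw [← Real.sqrt_sq (norm_nonneg c), ← norm_sq_szego hz c, ← hs2, ← mul_pow,
      Real.sqrt_sq (by positivity)]
  have hsq : s * ‖q‖ ≤ ‖(Yc z).adjoint v‖ := by
    refine le_of_sq_le_sq ?_ (norm_nonneg _)
    rwa [mul_pow, hs2]
  calc ‖v‖ = s * ‖x‖ := by rw [hx, hsz]
    _ ≤ s * (‖e‖ + ‖T.adjoint‖ * ‖szego z hz w‖) := by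
        gcongr
        have : x = e + T.adjoint (szego z hz w) := by rw [he, sub_add_cancel]
        rw [this]
        refine (norm_add_le _ _).trans ?_
        gcongr
        exact (T.adjoint : l2 m →L[ℂ] l2 p).le_opNorm _
    _ ≤ s * ((1 + K * ‖T‖) * ‖q‖ + ‖T.adjoint‖ * ‖szego z hz w‖) := by gcongr
    _ = (1 + K * ‖T‖) * (s * ‖q‖) + ‖T.adjoint‖ * (s * ‖szego z hz w‖) := by ring
    _ ≤ (1 + K * ‖T‖) * ‖(Yc z).adjoint v‖ +
          ‖T.adjoint‖ * (‖Ξ.adjoint‖ * ‖(Yc z).adjoint v‖) := by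
        rw [hsz]
        gcongr
        rw [hw]
        exact (Ξ.adjoint : ES p →L[ℂ] ES m).le_opNorm _
    _ = _ := by ring

end Toeplitz

/-- The operator between Euclidean spaces given by a matrix. -/
def matCLM {r s : ℕ} (M : Matrix (Fin r) (Fin s) ℂ) : ES s →L[ℂ] ES r :=
  (Matrix.toLpLin 2 2 M).toContinuousLinearMap

theorem matCLM_apply {r s : ℕ} (M : Matrix (Fin r) (Fin s) ℂ) (v : ES s) :
    matCLM M v = WithLp.toLp 2 (M *ᵥ v.ofLp) := rfl

theorem matCLM_injective {r s : ℕ} :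
    Function.Injective (matCLM : Matrix (Fin r) (Fin s) ℂ → _) := fun _ _ h =>
  (Matrix.toLpLin 2 2).injective (LinearMap.toContinuousLinearMap.injective h)

theorem matCLM_mul_apply {r s t : ℕ} (M : Matrix (Fin r) (Fin s) ℂ) (N : Matrix (Fin s) (Fin t) ℂ)
    (v : ES t) : matCLM (M * N) v = matCLM M (matCLM N v) := by
  simp [matCLM_apply]

theorem euclidean_ext_basis {n : ℕ} {F : Type*} [NormedAddCommGroup F] [NormedSpace ℂ F]
    {A B : ES n →L[ℂ] F} (h : ∀ b, A (eVec n b) = B (eVec n b)) : A = B := by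
  apply ContinuousLinearMap.coe_injective
  refine (EuclideanSpace.basisFun (Fin n) ℂ).toBasis.ext fun b => ?_
  simpa using h b

theorem matCLM_eq_of_entries {r s : ℕ} {M : Matrix (Fin r) (Fin s) ℂ} {A : ES s →L[ℂ] ES r}
    (h : ∀ a b, M a b = A (eVec s b) a) : matCLM M = A := by
  refine euclidean_ext_basis fun b => ?_
  ext a
  simp [matCLM_apply, h]

theorem matCLM_conjTranspose_apply {r s : ℕ} (M : Matrix (Fin r) (Fin s) ℂ) (v : ES r) :
    (matCLM M).adjoint v = matCLM Mᴴ v := by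
  refine ext_inner_left ℂ fun w => ?_
  rw [ContinuousLinearMap.adjoint_inner_right]
  simp only [matCLM_apply, EuclideanSpace.inner_eq_star_dotProduct]
  rw [Matrix.star_mulVec, dotProduct_comm, ← Matrix.dotProduct_mulVec,
    dotProduct_comm]

/-- A lower bound for `Aᴴ` bounds the entries of the inverse of `A`. -/
theorem isUnit_det_and_norm_inv_le {n : ℕ} {A : Matrix (Fin n) (Fin n) ℂ} {C : ℝ}
    (h : ∀ v, ‖v‖ ≤ C * ‖(matCLM A).adjoint v‖) :
    IsUnit A.det ∧ ∀ a b, ‖A⁻¹ a b‖ ≤ C := by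
  simp only [matCLM_conjTranspose_apply] at h
  have hu : IsUnit Aᴴ := by
    rw [← Matrix.mulVec_injective_iff_isUnit]
    intro x y hxy
    have h0 : Aᴴ *ᵥ (x - y) = 0 := by
      rw [Matrix.mulVec_sub, sub_eq_zero]
      exact hxy
    have := h (WithLp.toLp 2 (x - y))
    rw [matCLM_apply, h0] at this
    have h1 : (WithLp.toLp 2 (x - y) : ES n) = 0 := by
      rw [← norm_le_zero_iff]
      simpa using this
    exact sub_eq_zero.mp (congrArg WithLp.ofLp h1)
  have hdet := (Matrix.isUnit_iff_isUnit_det _).mp hu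
  refine ⟨by simpa [Matrix.det_conjTranspose] using hdet, fun a b => ?_⟩
  have h1 := h (matCLM (Aᴴ)⁻¹ (eVec n a))
  rw [← matCLM_mul_apply, Matrix.mul_nonsing_inv _ hdet] at h1
  have h2 : matCLM (1 : Matrix (Fin n) (Fin n) ℂ) (eVec n a) = eVec n a := by
    rw [matCLM_apply, Matrix.one_mulVec]
  rw [h2, PiLp.norm_single, norm_one, mul_one] at h1
  refine le_trans (le_of_eq ?_) ((PiLp.norm_apply_le _ b).trans h1)
  simp [matCLM_apply, ← Matrix.conjTranspose_nonsing_inv]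

/-- Bounded analytic matrix functions on the unit disc. -/
def IsHInfty {r s : ℕ} (F : ℂ → Matrix (Fin r) (Fin s) ℂ) : Prop :=
  (∀ a b, DifferentiableOn ℂ (fun z => F z a b) (Metric.ball 0 1)) ∧
    ∃ C : ℝ, ∀ z ∈ Metric.ball (0 : ℂ) 1, ∀ a b, ‖F z a b‖ ≤ C

theorem isHInfty_const {r s : ℕ} (M : Matrix (Fin r) (Fin s) ℂ) : IsHInfty fun _ => M :=
  ⟨fun _ _ => differentiableOn_const _, ∑ a, ∑ b, ‖M a b‖, fun _ _ a b =>
    (Finset.single_le_sum (f := fun b => ‖M a b‖) (fun _ _ => norm_nonneg _)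
      (Finset.mem_univ b)).trans
    (Finset.single_le_sum (f := fun a => ∑ b, ‖M a b‖)
      (fun _ _ => Finset.sum_nonneg fun _ _ => norm_nonneg _) (Finset.mem_univ a))⟩

theorem IsHInfty.mul {r s t : ℕ} {F : ℂ → Matrix (Fin r) (Fin s) ℂ}
    {H : ℂ → Matrix (Fin s) (Fin t) ℂ} (hF : IsHInfty F) (hH : IsHInfty H) :
    IsHInfty fun z => F z * H z := by
  obtain ⟨hFd, C, hC⟩ := hF
  obtain ⟨hHd, D, hD⟩ := hH
  refine ⟨fun a b => ?_, s * (C * D), fun z hz a b => ?_⟩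
  · simp only [Matrix.mul_apply]
    exact DifferentiableOn.fun_sum fun i _ => (hFd a i).mul (hHd i b)
  · change ‖(F z * H z) a b‖ ≤ _
    rw [Matrix.mul_apply]
    refine (norm_sum_le_of_le _ (f := fun i => F z a i * H z i b) (n := fun _ => C * D)
      fun i _ => ?_).trans_eq ?_
    · rw [norm_mul]
      exact mul_le_mul (hC z hz a i) (hD z hz i b) (norm_nonneg _)
        ((norm_nonneg _).trans (hC z hz a i))
    · simp

theorem IsHInfty.sub {r s : ℕ} {F H : ℂ → Matrix (Fin r) (Fin s) ℂ} (hF : IsHInfty F)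
    (hH : IsHInfty H) : IsHInfty fun z => F z - H z := by
  obtain ⟨hFd, C, hC⟩ := hF
  obtain ⟨hHd, D, hD⟩ := hH
  exact ⟨fun a b => (hFd a b).sub (hHd a b), C + D, fun z hz a b =>
    (norm_sub_le _ _).trans (add_le_add (hC z hz a b) (hD z hz a b))⟩

theorem differentiableOn_det {n : ℕ} {F : ℂ → Matrix (Fin n) (Fin n) ℂ} {s : Set ℂ}
    (hF : ∀ a b, DifferentiableOn ℂ (fun z => F z a b) s) :
    DifferentiableOn ℂ (fun z => (F z).det) s := by
  simp only [Matrix.det_apply]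
  exact DifferentiableOn.fun_sum fun σ _ =>
    (DifferentiableOn.fun_finsetProd fun i _ => hF (σ i) i).const_smul _

theorem differentiableOn_inv_apply {n : ℕ} {F : ℂ → Matrix (Fin n) (Fin n) ℂ} {s : Set ℂ}
    (hF : ∀ a b, DifferentiableOn ℂ (fun z => F z a b) s) (hdet : ∀ z ∈ s, IsUnit (F z).det)
    (a b : Fin n) : DifferentiableOn ℂ (fun z => (F z)⁻¹ a b) s := by
  simp only [Matrix.inv_def, Matrix.smul_apply, Ring.inverse_eq_inv', smul_eq_mul,
    Matrix.adjugate_apply]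
  refine ((differentiableOn_det hF).inv fun z hz => (hdet z hz).ne_zero).mul
    (differentiableOn_det fun i j => ?_)
  by_cases h : i = b
  · simp only [Matrix.updateRow_apply, h, if_true]
    exact differentiableOn_const _
  · simpa only [Matrix.updateRow_apply, h, if_false] using hF i j

/-- If `N Ξ = 1`, `N Θ = 0` and the injective matrix `Θ` has `p - m` columns, then `Θ` has a left
inverse `L`, and `Θ L` is the identity on `ker N`. -/
theorem exists_left_inverse_ker {m p : ℕ} (hmp : m ≤ p) {N : Matrix (Fin m) (Fin p) ℂ}
    {Ξ : Matrix (Fin p) (Fin m) ℂ} {Θ : Matrix (Fin p) (Fin (p - m)) ℂ} (hΞ : N * Ξ = 1)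
    (hΘ : N * Θ = 0) (hker : ∀ w, Θ *ᵥ w = 0 → w = 0) :
    ∃ L : Matrix (Fin (p - m)) (Fin p) ℂ, ∀ (s : ℕ) (W : Matrix (Fin p) (Fin s) ℂ),
      N * W = 0 → Θ * (L * W) = W := by
  obtain ⟨l, hl⟩ := LinearMap.exists_leftInverse_of_injective Θ.mulVecLin
    (LinearMap.ker_eq_bot'.mpr hker)
  have hl' : ∀ w, l (Θ *ᵥ w) = w := fun w => LinearMap.congr_fun hl w
  have hsurj : Function.Surjective (Ξ.mulVecLin.coprod Θ.mulVecLin) := by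
    rw [← LinearMap.injective_iff_surjective_of_finrank_eq_finrank (by simp [hmp]),
      ← LinearMap.ker_eq_bot, LinearMap.ker_eq_bot']
    rintro ⟨a, b⟩ hab
    have hab' : Ξ *ᵥ a + Θ *ᵥ b = 0 := by simpa using hab
    have ha : a = 0 := by
      have := congrArg (N *ᵥ ·) hab'
      simpa [Matrix.mulVec_add, hΞ, hΘ] using this
    rw [ha, Matrix.mulVec_zero, zero_add] at hab'
    simp [ha, hker b hab']
  have hvec : ∀ w, N *ᵥ w = 0 → Θ *ᵥ l w = w := by
    intro w hw
    obtain ⟨⟨a, b⟩, hab⟩ := hsurj w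
    have hab' : Ξ *ᵥ a + Θ *ᵥ b = w := by simpa using hab
    have ha : a = 0 := by
      have := congrArg (N *ᵥ ·) hab'
      simpa [Matrix.mulVec_add, hΞ, hΘ, hw] using this
    rw [ha, Matrix.mulVec_zero, zero_add] at hab'
    rw [← hab', hl']
  refine ⟨LinearMap.toMatrix' l, fun s W hW => ?_⟩
  refine Matrix.ext_of_mulVec_single fun i => ?_
  rw [← Matrix.mulVec_mulVec, ← Matrix.mulVec_mulVec, LinearMap.toMatrix'_mulVec]
  refine hvec _ ?_
  rw [Matrix.mulVec_mulVec, hW, Matrix.zero_mulVec]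

/-- A block Toeplitz operator acts as multiplication by its symbol. -/
theorem diskEval_toeplitz {m p : ℕ} {G : ℕ → Matrix (Fin m) (Fin p) ℂ} {TG : l2 p →L[ℂ] l2 m}
    (hTG : ∀ (j : ℕ) (b : Fin p) (i : ℕ) (a : Fin m),
      (TG (lp.single 2 j (eVec p b))) i a = if j ≤ i then G (i - j) a b else 0)
    (z : ℂ) (hz : ‖z‖ < 1) (g : l2 p) :
    diskEval z hz (TG g) = matCLM (seriesM G z) (diskEval z hz g) := by
  suffices h : (diskEval z hz).comp TG = (matCLM (seriesM G z)).comp (diskEval z hz) from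
    DFunLike.congr_fun h g
  refine l2_ext_basis fun j b => ?_
  ext a
  have hG : HasSum (fun i => z ^ i * G i a b) (seriesM G z a b) := by
    have h := diskEval_apply_hasSum hz (TG (lp.single 2 0 (eVec p b))) a
    simp only [hTG, zero_le, if_true, Nat.sub_zero] at h
    exact h.summable.hasSum
  have h1 := diskEval_apply_hasSum hz (TG (lp.single 2 j (eVec p b))) a
  have h2 : HasSum (fun i => z ^ i * (TG (lp.single 2 j (eVec p b))) i a)
      (z ^ j * seriesM G z a b) := by
    rw [← (add_left_injective j).hasSum_iff]
    · refine (hG.mul_left (z ^ j)).congr_fun fun i => ?_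
      simp only [Function.comp_apply, hTG, Nat.le_add_left, if_true, Nat.add_sub_cancel]
      ring
    · intro i hi
      have : ¬ j ≤ i := fun h => hi ⟨i - j, Nat.sub_add_cancel h⟩
      simp [hTG, this]
  rw [ContinuousLinearMap.comp_apply, ContinuousLinearMap.comp_apply, h1.unique h2,
    diskEval_single, map_smul]
  simp [matCLM_apply]

section Main

variable {m p : ℕ} {G : ℕ → Matrix (Fin m) (Fin p) ℂ} {TG HG : l2 p →L[ℂ] l2 m}

/-- The embedding of `ℂⁿ` as the zeroth coordinate, as a continuous linear map. -/
abbrev embedZero (n : ℕ) : ES n →L[ℂ] l2 n :=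
  lp.singleContinuousLinearMap ℂ (fun _ => ES n) 2 0

theorem toeplitz_embedZero
    (hTG : ∀ (j : ℕ) (b : Fin p) (i : ℕ) (a : Fin m),
      (TG (lp.single 2 j (eVec p b))) i a = if j ≤ i then G (i - j) a b else 0)
    (hHG : ∀ (j : ℕ) (b : Fin p) (i : ℕ) (a : Fin m),
      (HG (lp.single 2 j (eVec p b))) i a = G (i + j + 1) a b) (c : ES p) :
    TG (embedZero p c) = embedZero m (matCLM (seriesM G 0) c) + shiftUp (HG (embedZero p c)) := by
  have hd : shiftDown (TG (embedZero p c)) = HG (embedZero p c) := by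
    refine lp.ext (funext fun i => ?_)
    have : ((lp.evalCLM ℂ (fun _ : ℕ => ES m) 2 (i + 1)).comp (TG.comp (embedZero p))) =
        ((lp.evalCLM ℂ (fun _ : ℕ => ES m) 2 i).comp (HG.comp (embedZero p))) := by
      refine euclidean_ext_basis fun b => ?_
      ext a
      change (TG (lp.single 2 0 (eVec p b))) (i + 1) a = (HG (lp.single 2 0 (eVec p b))) i a
      simp [hTG, hHG]
    rw [shiftDown_apply]
    exact DFunLike.congr_fun this c
  have h0 : (TG (embedZero p c)) 0 = matCLM (seriesM G 0) c := by
    rw [← diskEval_zero, diskEval_toeplitz hTG, diskEval_zero]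
    congr 1
  refine lp.ext (funext fun i => ?_)
  rw [← hd]
  cases i with
  | zero =>
    rw [h0]
    simp
  | succ i => simp

theorem isHInfty_of_resolvent {n : ℕ} {Y : ℂ → Matrix (Fin n) (Fin n) ℂ} {u : Fin n → l2 n}
    (hY : ∀ z ∈ Metric.ball (0 : ℂ) 1, ∀ (a b : Fin n),
      Y z a b = (if a = b then 1 else 0) - z * ∑' i : ℕ, z ^ i * u b i a)
    (hYbdd : ∃ C : ℝ, ∀ z ∈ Metric.ball (0 : ℂ) 1, ∀ a b : Fin n, ‖Y z a b‖ ≤ C) :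
    IsHInfty Y :=
  ⟨fun a b => DifferentiableOn.congr ((differentiableOn_const _).sub
    (differentiableOn_id.mul (differentiableOn_tsum_l2 (u b) a))) fun z hz => hY z hz a b, hYbdd⟩

theorem isHInfty_iff_analyticOnNhd {r s : ℕ} {F : ℂ → Matrix (Fin r) (Fin s) ℂ} :
    IsHInfty F ↔ (∀ a b, AnalyticOnNhd ℂ (fun z => F z a b) (Metric.ball 0 1)) ∧
      ∃ C : ℝ, ∀ z ∈ Metric.ball (0 : ℂ) 1, ∀ a b, ‖F z a b‖ ≤ C := by
  simp only [IsHInfty, Complex.analyticOnNhd_iff_differentiableOn Metric.isOpen_ball]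

variable {Tinv : l2 m →L[ℂ] l2 m} {Ξ₀ : Matrix (Fin p) (Fin m) ℂ}
  {Θ₀ : Matrix (Fin p) (Fin (p - m)) ℂ} {Y : ℂ → Matrix (Fin p) (Fin p) ℂ}

theorem seriesM_zero_mul_Xi
    (hTG : ∀ (j : ℕ) (b : Fin p) (i : ℕ) (a : Fin m),
      (TG (lp.single 2 j (eVec p b))) i a = if j ≤ i then G (i - j) a b else 0)
    (hT2 : ∀ x, TG (TG.adjoint (Tinv x)) = x)
    (hΞ₀ : ∀ (a : Fin p) (b : Fin m),
      Ξ₀ a b = (TG.adjoint (Tinv (lp.single 2 0 (eVec m b)))) 0 a) :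
    seriesM G 0 * Ξ₀ = 1 := by
  apply matCLM_injective
  refine euclidean_ext_basis fun b => ?_
  have h : matCLM Ξ₀ (eVec m b) =
      diskEval 0 (by simp) (TG.adjoint (Tinv (lp.single 2 0 (eVec m b)))) := by
    ext a
    simp [matCLM_apply, hΞ₀, diskEval_zero]
  rw [matCLM_mul_apply, h, ← diskEval_toeplitz hTG, hT2, diskEval_single, matCLM_apply,
    Matrix.one_mulVec, pow_zero, one_smul]

open scoped ComplexOrder in
theorem seriesM_zero_mul_Theta
    (hTG : ∀ (j : ℕ) (b : Fin p) (i : ℕ) (a : Fin m),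
      (TG (lp.single 2 j (eVec p b))) i a = if j ≤ i then G (i - j) a b else 0)
    (hT2 : ∀ x, TG (TG.adjoint (Tinv x)) = x)
    (hΘ₀ : ∀ (a b : Fin p), (Θ₀ * Θ₀ᴴ) a b
      = (if a = b then 1 else 0) - (TG.adjoint (Tinv (TG (lp.single 2 0 (eVec p b))))) 0 a) :
    seriesM G 0 * Θ₀ = 0 := by
  rw [← Matrix.mul_self_mul_conjTranspose_eq_zero]
  apply matCLM_injective
  refine euclidean_ext_basis fun b => ?_
  have h : matCLM (Θ₀ * Θ₀ᴴ) (eVec p b) = diskEval 0 (by simp) (lp.single 2 0 (eVec p b)) -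
      diskEval 0 (by simp) (TG.adjoint (Tinv (TG (lp.single 2 0 (eVec p b))))) := by
    ext a
    rw [diskEval_single, diskEval_zero, matCLM_apply]
    simp [hΘ₀]
  rw [matCLM_mul_apply, h, map_sub, ← diskEval_toeplitz hTG, ← diskEval_toeplitz hTG, hT2, sub_self,
    matCLM_apply, Matrix.zero_mulVec]
  rfl

/-- The sequence whose generating function is `z ↦ Y(z) c`. -/
abbrev resolventSeq (TG HG : l2 p →L[ℂ] l2 m) (Tinv : l2 m →L[ℂ] l2 m) (c : ES p) : l2 p :=
  embedZero p c - shiftUp (TG.adjoint (Tinv (HG (embedZero p c))))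

theorem diskEval_resolventSeq
    (hY : ∀ z ∈ Metric.ball (0 : ℂ) 1, ∀ (a b : Fin p),
      Y z a b = (if a = b then 1 else 0)
        - z * ∑' i : ℕ, z ^ i *
            (TG.adjoint (Tinv (HG (lp.single 2 0 (eVec p b))))) i a)
    (z : ℂ) (hz : ‖z‖ < 1) (c : ES p) :
    diskEval z hz (resolventSeq TG HG Tinv c) = matCLM (Y z) c := by
  have h : matCLM (Y z) = ContinuousLinearMap.id ℂ (ES p) -
      z • (diskEval z hz).comp (TG.adjoint.comp (Tinv.comp (HG.comp (embedZero p)))) := by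
    refine matCLM_eq_of_entries fun a b => ?_
    rw [hY z (by simpa using hz), (diskEval_apply_hasSum hz _ a).tsum_eq]
    simp
  rw [h, map_sub, diskEval_shiftUp]
  simp [diskEval_single]

theorem seriesM_mul_resolvent
    (hTG : ∀ (j : ℕ) (b : Fin p) (i : ℕ) (a : Fin m),
      (TG (lp.single 2 j (eVec p b))) i a = if j ≤ i then G (i - j) a b else 0)
    (hHG : ∀ (j : ℕ) (b : Fin p) (i : ℕ) (a : Fin m),
      (HG (lp.single 2 j (eVec p b))) i a = G (i + j + 1) a b)
    (hT2 : ∀ x, TG (TG.adjoint (Tinv x)) = x)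
    (hY : ∀ z ∈ Metric.ball (0 : ℂ) 1, ∀ (a b : Fin p),
      Y z a b = (if a = b then 1 else 0)
        - z * ∑' i : ℕ, z ^ i *
            (TG.adjoint (Tinv (HG (lp.single 2 0 (eVec p b))))) i a)
    {z : ℂ} (hz : ‖z‖ < 1) : seriesM G z * Y z = seriesM G 0 := by
  apply matCLM_injective
  ext1 c
  rw [matCLM_mul_apply, ← diskEval_resolventSeq hY z hz, ← diskEval_toeplitz hTG, map_sub,
    map_shiftUp (diskEval_toeplitz hTG), hT2, toeplitz_embedZero hTG hHG, add_sub_cancel_right,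
    lp.singleContinuousLinearMap_apply, diskEval_single, pow_zero, one_smul]

/-- The function `Y` is invertible outer. -/
theorem isUnit_det_and_isHInfty_inv
    (hTG : ∀ (j : ℕ) (b : Fin p) (i : ℕ) (a : Fin m),
      (TG (lp.single 2 j (eVec p b))) i a = if j ≤ i then G (i - j) a b else 0)
    (hHG : ∀ (j : ℕ) (b : Fin p) (i : ℕ) (a : Fin m),
      (HG (lp.single 2 j (eVec p b))) i a = G (i + j + 1) a b)
    (hT2 : ∀ x, TG (TG.adjoint (Tinv x)) = x)
    (hΞ : seriesM G 0 * Ξ₀ = 1)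
    (hY : ∀ z ∈ Metric.ball (0 : ℂ) 1, ∀ (a b : Fin p),
      Y z a b = (if a = b then 1 else 0)
        - z * ∑' i : ℕ, z ^ i *
            (TG.adjoint (Tinv (HG (lp.single 2 0 (eVec p b))))) i a)
    (hYH : IsHInfty Y) :
    (∀ z ∈ Metric.ball (0 : ℂ) 1, IsUnit (Y z).det) ∧ IsHInfty fun z => (Y z)⁻¹ := by
  obtain ⟨hYΞd, hYΞb⟩ := hYH.mul (isHInfty_const Ξ₀)
  obtain ⟨K, hK, hmul⟩ := exists_bounded_mul_l2 _ hYΞd hYΞb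
  obtain ⟨C, -, hC⟩ := exists_norm_le_adjoint (Gc := fun z => matCLM (seriesM G z))
    (Yc := fun z => matCLM (Y z)) (y := resolventSeq TG HG Tinv) hT2 (diskEval_toeplitz hTG)
    (diskEval_resolventSeq hY) (fun c => by simp)
    (fun c => ⟨-Tinv (HG (embedZero p c)), by
      refine lp.ext (funext fun i => ?_)
      simp⟩)
    (fun z hz c => by rw [← matCLM_mul_apply, seriesM_mul_resolvent hTG hHG hT2 hY hz])
    (matCLM Ξ₀)
    (fun c => by rw [← matCLM_mul_apply, hΞ, matCLM_apply, Matrix.one_mulVec]) hK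
    (fun u => by
      obtain ⟨g, hg, hgz⟩ := hmul u
      exact ⟨g, hg, fun z hz => by rw [hgz z hz, ← matCLM_mul_apply, matCLM_apply]⟩)
  have hinv : ∀ z ∈ Metric.ball (0 : ℂ) 1, IsUnit (Y z).det ∧ ∀ a b, ‖(Y z)⁻¹ a b‖ ≤ C :=
    fun z hz => isUnit_det_and_norm_inv_le (hC z (by simpa using hz))
  exact ⟨fun z hz => (hinv z hz).1,
    differentiableOn_inv_apply hYH.1 fun z hz => (hinv z hz).1, C, fun z hz => (hinv z hz).2⟩

end Main

/-- If `G ∈ H^∞_{m×p}` with `T_G T_G*` strictly positive and the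
associated function `Y` is in `H^∞_{p×p}` (bounded on 𝔻), then `Y(·)⁻¹ ∈ H^∞_{p×p}`
(`Y` is invertible outer), and `X ∈ H^∞_{p×m}` solves `G(z)X(z) = I_m` on 𝔻 iff
`X(z) = Y(z)Ξ₀ + Y(z)Θ₀V(z)` for some `V ∈ H^∞_{(p−m)×m}`.  (`H^∞` membership of a
matrix function = entrywise analyticity on the ball together with a uniform bound.) -/
theorem bezout_corona_stmt18
    (m p : ℕ) (hm : 0 < m) (hmp : m ≤ p)
    (G : ℕ → Matrix (Fin m) (Fin p) ℂ)
    (TG : l2 p →L[ℂ] l2 m)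
    (hTG : ∀ (j : ℕ) (b : Fin p) (i : ℕ) (a : Fin m),
      (TG (lp.single 2 j (eVec p b))) i a = if j ≤ i then G (i - j) a b else 0)
    (HG : l2 p →L[ℂ] l2 m)
    (hHG : ∀ (j : ℕ) (b : Fin p) (i : ℕ) (a : Fin m),
      (HG (lp.single 2 j (eVec p b))) i a = G (i + j + 1) a b)
    (Tinv : l2 m →L[ℂ] l2 m)
    (hT1 : ∀ x, Tinv (TG (TG.adjoint x)) = x)
    (hT2 : ∀ x, TG (TG.adjoint (Tinv x)) = x)
    (Ξ₀ : Matrix (Fin p) (Fin m) ℂ)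
    (hΞ₀ : ∀ (a : Fin p) (b : Fin m),
      Ξ₀ a b = (TG.adjoint (Tinv (lp.single 2 0 (eVec m b)))) 0 a)
    (Θ₀ : Matrix (Fin p) (Fin (p - m)) ℂ)
    (hΘ₀ker : ∀ w : Fin (p - m) → ℂ, Θ₀.mulVec w = 0 → w = 0)
    (hΘ₀ : ∀ (a b : Fin p), (Θ₀ * Θ₀ᴴ) a b
      = (if a = b then 1 else 0) - (TG.adjoint (Tinv (TG (lp.single 2 0 (eVec p b))))) 0 a)
    (Y : ℂ → Matrix (Fin p) (Fin p) ℂ)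
    (hY : ∀ z ∈ Metric.ball (0 : ℂ) 1, ∀ (a b : Fin p),
      Y z a b = (if a = b then 1 else 0)
        - z * ∑' i : ℕ, z ^ i *
            (TG.adjoint (Tinv (HG (lp.single 2 0 (eVec p b))))) i a)
    -- `Y ∈ H^∞_{p×p}`
    (hYbdd : ∃ C : ℝ, ∀ z ∈ Metric.ball (0 : ℂ) 1, ∀ a b : Fin p, ‖Y z a b‖ ≤ C) :
    -- `Y` is invertible outer: `Y(·)⁻¹ ∈ H^∞_{p×p}`
    ((∀ a b : Fin p, AnalyticOnNhd ℂ (fun z => (Y z)⁻¹ a b) (Metric.ball 0 1)) ∧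
      ∃ C : ℝ, ∀ z ∈ Metric.ball (0 : ℂ) 1, ∀ a b : Fin p, ‖(Y z)⁻¹ a b‖ ≤ C) ∧
    -- description of all `H^∞` solutions
    ∀ X : ℂ → Matrix (Fin p) (Fin m) ℂ,
      (∀ a b, AnalyticOnNhd ℂ (fun z => X z a b) (Metric.ball 0 1)) →
      (∃ C : ℝ, ∀ z ∈ Metric.ball (0 : ℂ) 1, ∀ a b, ‖X z a b‖ ≤ C) →
      ((∀ z ∈ Metric.ball (0 : ℂ) 1, seriesM G z * X z = 1) ↔
        ∃ V : ℂ → Matrix (Fin (p - m)) (Fin m) ℂ,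
          (∀ a b, AnalyticOnNhd ℂ (fun z => V z a b) (Metric.ball 0 1)) ∧
          (∃ C : ℝ, ∀ z ∈ Metric.ball (0 : ℂ) 1, ∀ a b, ‖V z a b‖ ≤ C) ∧
          ∀ z ∈ Metric.ball (0 : ℂ) 1, X z = Y z * Ξ₀ + Y z * Θ₀ * V z) := by
  have hYH : IsHInfty Y := isHInfty_of_resolvent hY hYbdd
  have hΞ : seriesM G 0 * Ξ₀ = 1 := seriesM_zero_mul_Xi hTG hT2 hΞ₀
  have hΘ : seriesM G 0 * Θ₀ = 0 := seriesM_zero_mul_Theta hTG hT2 hΘ₀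
  have hGY : ∀ z ∈ Metric.ball (0 : ℂ) 1, seriesM G z * Y z = seriesM G 0 := fun z hz =>
    seriesM_mul_resolvent hTG hHG hT2 hY (by simpa using hz)
  obtain ⟨hdet, hYinv⟩ := isUnit_det_and_isHInfty_inv hTG hHG hT2 hΞ hY hYH
  refine ⟨isHInfty_iff_analyticOnNhd.mp hYinv, fun X hXa hXb => ⟨fun hX => ?_, ?_⟩⟩
  · obtain ⟨L, hL⟩ := exists_left_inverse_ker hmp hΞ hΘ hΘ₀ker
    obtain ⟨hVa, hVb⟩ := isHInfty_iff_analyticOnNhd.mp ((isHInfty_const L).mul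
      ((hYinv.mul (isHInfty_iff_analyticOnNhd.mpr ⟨hXa, hXb⟩)).sub (isHInfty_const Ξ₀)))
    refine ⟨_, hVa, hVb, fun z hz => ?_⟩
    have hker : seriesM G 0 * ((Y z)⁻¹ * X z - Ξ₀) = 0 := by
      rw [Matrix.mul_sub, hΞ, ← hGY z hz, Matrix.mul_assoc,
        Matrix.mul_nonsing_inv_cancel_left _ _ (hdet z hz), hX z hz, sub_self]
    rw [Matrix.mul_assoc, hL _ _ hker, ← Matrix.mul_add, add_sub_cancel,
      Matrix.mul_nonsing_inv_cancel_left _ _ (hdet z hz)]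
  · rintro ⟨V, -, -, hV⟩ z hz
    rw [hV z hz, Matrix.mul_assoc, ← Matrix.mul_add, ← Matrix.mul_assoc, hGY z hz, Matrix.mul_add,
      hΞ, ← Matrix.mul_assoc, hΘ, Matrix.zero_mul, add_zero]
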